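/- Let φ_1, …, φ_5 ∈ ℂ^3 and ψ_1, …, ψ_5 ∈ ℂ^3 be such that every triple of the φ's is linearly independent and every triple of the ψ's is linearly independent. Then the following are equivalent: (i) there exist A, B ∈ SL(3,ℂ) and nonzero scalars c_1, …, c_5 ∈ ℂ such that the product vectors c_i·(A φ_i) ⊗ (B ψ_i), i = 1, …, 5, are mutually orthogonal and form an orthogonal Unextendible Product Basis; (ii) there exists a permutation κ of {1, …, 5} such that the invariants s_1, s_2, s_3, s_4 computed from the permuted vectors φ_{κ(1)}, …, φ_{κ(5)} and ψ_{κ(1)}, …, ψ_{κ(5)} are all positive real numbers. -/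

import Mathlib

open scoped ComplexConjugate

/-- The standard Hermitian inner product, conjugate-linear in the first argument. -/
noncomputable def hinner {α : Type*} [Fintype α] (x y : α → ℂ) : ℂ :=
  ∑ a, conj (x a) * y a

/-- The product vector `φ ⊗ ψ` in `ℂ^n ⊗ ℂ^m`, identified with `Fin n × Fin m → ℂ`. -/
noncomputable def prodVec {n m : ℕ} (φ : Fin n → ℂ) (ψ : Fin m → ℂ) :
    Fin n × Fin m → ℂ :=
  fun p => φ p.1 * ψ p.2

/-- Determinant of the 3×3 matrix with columns `u`, `v`, `w`. -/
noncomputable def det3 (u v w : Fin 3 → ℂ) : ℂ :=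
  Matrix.det (Matrix.of fun i j => ![u, v, w] j i)

/-- The invariant `s₁` of five vectors in `ℂ^3`. -/
noncomputable def s1 (φ : Fin 5 → Fin 3 → ℂ) : ℂ :=
  (-(det3 (φ 0) (φ 1) (φ 3) * det3 (φ 0) (φ 2) (φ 4))) /
    (det3 (φ 0) (φ 1) (φ 4) * det3 (φ 0) (φ 2) (φ 3))

/-- The invariant `s₂` of five vectors in `ℂ^3`. -/
noncomputable def s2 (φ : Fin 5 → Fin 3 → ℂ) : ℂ :=
  (-(det3 (φ 0) (φ 1) (φ 2) * det3 (φ 1) (φ 3) (φ 4))) /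
    (det3 (φ 0) (φ 1) (φ 3) * det3 (φ 1) (φ 2) (φ 4))

/-- The invariant `s₃` of five vectors in `ℂ^3`. -/
noncomputable def s3 (ψ : Fin 5 → Fin 3 → ℂ) : ℂ :=
  (-(det3 (ψ 0) (ψ 2) (ψ 1) * det3 (ψ 0) (ψ 4) (ψ 3))) /
    (det3 (ψ 0) (ψ 2) (ψ 3) * det3 (ψ 0) (ψ 4) (ψ 1))

/-- The invariant `s₄` of five vectors in `ℂ^3`. -/
noncomputable def s4 (ψ : Fin 5 → Fin 3 → ℂ) : ℂ :=
  (-(det3 (ψ 0) (ψ 2) (ψ 4) * det3 (ψ 2) (ψ 1) (ψ 3))) /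
    (det3 (ψ 0) (ψ 2) (ψ 1) * det3 (ψ 2) (ψ 4) (ψ 3))

/-- A complex number is a positive real. -/
def IsPosReal (z : ℂ) : Prop := z.im = 0 ∧ 0 < z.re

section InnerProducts

theorem hinner_conj_symm {α : Type*} [Fintype α] (x y : α → ℂ) :
    conj (hinner x y) = hinner y x := by
  simp [hinner, mul_comm]

theorem hinner_eq_zero_symm {α : Type*} [Fintype α] {x y : α → ℂ} (h : hinner x y = 0) :
    hinner y x = 0 := by
  rw [← hinner_conj_symm, h, map_zero]

theorem hinner_smul_left {α : Type*} [Fintype α] (c : ℂ) (x y : α → ℂ) :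
    hinner (c • x) y = conj c * hinner x y := by
  simp [hinner, Finset.mul_sum, mul_assoc]

theorem hinner_smul_right {α : Type*} [Fintype α] (c : ℂ) (x y : α → ℂ) :
    hinner x (c • y) = c * hinner x y := by
  simp [hinner, Finset.mul_sum, mul_left_comm]

theorem hinner_prodVec {n m : ℕ} (a f : Fin n → ℂ) (b g : Fin m → ℂ) :
    hinner (prodVec a b) (prodVec f g) = hinner a f * hinner b g := by
  simp only [hinner, prodVec, Fintype.sum_prod_type, Finset.sum_mul_sum, map_mul]
  exact Finset.sum_congr rfl fun i _ => Finset.sum_congr rfl fun j _ => by ring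

theorem hinner_self_eq_ofReal {α : Type*} [Fintype α] (x : α → ℂ) :
    hinner x x = ((∑ a, Complex.normSq (x a) : ℝ) : ℂ) := by
  simp [hinner, Complex.normSq_eq_conj_mul_self]

end InnerProducts

section Determinants

theorem det3_mulVec (A : Matrix (Fin 3) (Fin 3) ℂ) (u v w : Fin 3 → ℂ) :
    det3 (A.mulVec u) (A.mulVec v) (A.mulVec w) = A.det * det3 u v w := by
  rw [det3, det3, ← Matrix.det_mul]
  congr 1
  ext i j
  fin_cases j <;> simp [Matrix.mul_apply, Matrix.mulVec, dotProduct]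

/-- The Gram determinant identity. -/
theorem conj_det3_mul_det3 (a b c x y z : Fin 3 → ℂ) :
    conj (det3 a b c) * det3 x y z =
      hinner a x * (hinner b y * hinner c z - hinner b z * hinner c y) -
      hinner a y * (hinner b x * hinner c z - hinner b z * hinner c x) +
      hinner a z * (hinner b x * hinner c y - hinner b y * hinner c x) := by
  simp only [det3, hinner, Matrix.det_fin_three, Matrix.of_apply, Fin.sum_univ_three,
    Matrix.cons_val, map_add, map_sub, map_mul]
  ring

theorem eq_zero_of_hinner_eq_zero {a b c x : Fin 3 → ℂ} (h : det3 a b c ≠ 0)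
    (ha : hinner a x = 0) (hb : hinner b x = 0) (hc : hinner c x = 0) : x = 0 := by
  have hM : (Matrix.conjTranspose (Matrix.of fun i j => ![a, b, c] j i)).det ≠ 0 := by
    rw [Matrix.det_conjTranspose]
    exact star_ne_zero.mpr h
  refine Matrix.eq_zero_of_mulVec_eq_zero hM ?_
  ext i
  fin_cases i
  · simpa [Matrix.mulVec, dotProduct, hinner] using ha
  · simpa [Matrix.mulVec, dotProduct, hinner] using hb
  · simpa [Matrix.mulVec, dotProduct, hinner] using hc

/-- Any three vectors of the family span `ℂ^3`. -/
def GeneralPosition {ι : Type*} (φ : ι → Fin 3 → ℂ) : Prop :=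
  ∀ i j k, i ≠ j → i ≠ k → j ≠ k → det3 (φ i) (φ j) (φ k) ≠ 0

theorem generalPosition_of_linearIndependent {φ : Fin 5 → Fin 3 → ℂ}
    (hφ : ∀ S : Finset (Fin 5), S.card = 3 →
      LinearIndependent ℂ (fun i : {x // x ∈ S} => φ i.1)) : GeneralPosition φ := by
  intro i j k hij hik hjk
  have h := (hφ {i, j, k} (Finset.card_eq_three.mpr ⟨i, j, k, hij, hik, hjk, rfl⟩)).comp
    ![⟨i, by simp⟩, ⟨j, by simp⟩, ⟨k, by simp⟩] (by
      simp [Function.Injective, Fin.forall_fin_succ, hij, hij.symm, hik, hik.symm, hjk, hjk.symm])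
  have hcol : LinearIndependent ℂ
      (Matrix.of fun a b => ![φ i, φ j, φ k] b a : Matrix (Fin 3) (Fin 3) ℂ).col := by
    convert h using 1
    ext a b
    fin_cases a <;> rfl
  exact ((Matrix.isUnit_iff_isUnit_det _).mp
    (Matrix.linearIndependent_cols_iff_isUnit.mp hcol)).ne_zero

theorem GeneralPosition.comp {ι κ : Type*} {φ : ι → Fin 3 → ℂ} (h : GeneralPosition φ)
    {f : κ → ι} (hf : Function.Injective f) : GeneralPosition (φ ∘ f) :=
  fun _ _ _ hij hik hjk => h _ _ _ (hf.ne hij) (hf.ne hik) (hf.ne hjk)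

theorem GeneralPosition.mulVec {ι : Type*} {φ : ι → Fin 3 → ℂ} (h : GeneralPosition φ)
    {A : Matrix (Fin 3) (Fin 3) ℂ} (hA : A.det = 1) :
    GeneralPosition fun i => A.mulVec (φ i) := by
  intro i j k hij hik hjk
  rw [det3_mulVec, hA, one_mul]
  exact h i j k hij hik hjk

theorem GeneralPosition.ne_zero {φ : Fin 5 → Fin 3 → ℂ} (h : GeneralPosition φ) (i : Fin 5) :
    φ i ≠ 0 := by
  obtain ⟨j, k, hij, hik, hjk⟩ : ∃ j k : Fin 5, i ≠ j ∧ i ≠ k ∧ j ≠ k := by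
    decide +revert
  intro h0
  apply h i j k hij hik hjk
  simp [det3, Matrix.det_fin_three, h0]

/-- Fewer than three members of a family in general position are orthogonal to a given
nonzero vector. -/
theorem GeneralPosition.card_orthogonal_le {ι : Type*} {φ : ι → Fin 3 → ℂ}
    (h : GeneralPosition φ) {f : Fin 3 → ℂ} (hf : f ≠ 0) {S : Finset ι}
    (hS : ∀ i ∈ S, hinner (φ i) f = 0) : S.card ≤ 2 := by
  by_contra! hc
  obtain ⟨a, b, c, ha, hb, hc, hab, hac, hbc⟩ := Finset.two_lt_card_iff.mp hc
  exact hf (eq_zero_of_hinner_eq_zero (h a b c hab hac hbc) (hS a ha) (hS b hb) (hS c hc))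

end Determinants

section Invariants

theorem IsPosReal.exists_ofReal {z : ℂ} (h : IsPosReal z) : ∃ r : ℝ, 0 < r ∧ z = r :=
  ⟨z.re, h.2, Complex.ext rfl (by simpa using h.1)⟩

theorem isPosReal_ofReal {r : ℝ} (h : 0 < r) : IsPosReal (r : ℂ) :=
  ⟨Complex.ofReal_im r, by simpa using h⟩

theorem s1_mulVec {A : Matrix (Fin 3) (Fin 3) ℂ} (hA : A.det = 1) (φ : Fin 5 → Fin 3 → ℂ) :
    s1 (fun i => A.mulVec (φ i)) = s1 φ := by
  simp only [s1, det3_mulVec, hA, one_mul]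

theorem s2_mulVec {A : Matrix (Fin 3) (Fin 3) ℂ} (hA : A.det = 1) (φ : Fin 5 → Fin 3 → ℂ) :
    s2 (fun i => A.mulVec (φ i)) = s2 φ := by
  simp only [s2, det3_mulVec, hA, one_mul]

theorem s1_reflect (φ : Fin 5 → Fin 3 → ℂ) : s1 (φ ∘ fun i => 1 - i) = (s2 φ)⁻¹ := by
  have swap (u v w) : det3 v u w = -det3 u v w := by
    simp [det3, Matrix.det_fin_three]; ring
  have swap' (u v w) : det3 u w v = -det3 u v w := by
    simp [det3, Matrix.det_fin_three]; ring
  have e2 : (1 - 2 : Fin 5) = 4 := rfl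
  have e3 : (1 - 3 : Fin 5) = 3 := rfl
  have e4 : (1 - 4 : Fin 5) = 2 := rfl
  simp only [s1, s2, Function.comp_apply, sub_zero, sub_self, e2, e3, e4]
  rw [swap (φ 0) (φ 1), swap (φ 0) (φ 1), swap' (φ 1) (φ 2) (φ 4), swap' (φ 1) (φ 3) (φ 4),
    inv_div, neg_mul_neg, neg_mul_neg, neg_div, div_neg]

theorem s3_eq_s1 (ψ : Fin 5 → Fin 3 → ℂ) : s3 ψ = s1 (ψ ∘ fun i => 2 * i) := rfl

theorem s4_eq_s2 (ψ : Fin 5 → Fin 3 → ℂ) : s4 ψ = s2 (ψ ∘ fun i => 2 * i) := rfl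

theorem isPosReal_of_mul_eq_ofReal {z : ℂ} {p q : ℝ} (hp : 0 < p) (hq : 0 ≤ q) (hz : z ≠ 0)
    (h : z * p = q) : IsPosReal z := by
  have hp' : (p : ℂ) ≠ 0 := by exact_mod_cast hp.ne'
  have hzq : z = ((q / p : ℝ) : ℂ) := by rw [Complex.ofReal_div, ← h, mul_div_cancel_right₀ _ hp']
  rw [hzq] at hz ⊢
  exact isPosReal_ofReal ((div_nonneg hq hp.le).lt_of_ne' (by exact_mod_cast hz))

/-- The invariant `s₁` of an orthogonal pentagon is positive. -/
theorem isPosReal_s1_of_pentagon {w : Fin 5 → Fin 3 → ℂ} (hw : GeneralPosition w)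
    (h : ∀ i, hinner (w i) (w (i + 1)) = 0) : IsPosReal (s1 w) := by
  have h01 : hinner (w 0) (w 1) = 0 := h 0
  have h12 : hinner (w 1) (w 2) = 0 := h 1
  have h23 : hinner (w 2) (w 3) = 0 := h 2
  have h34 : hinner (w 3) (w 4) = 0 := h 3
  have h40 : hinner (w 4) (w 0) = 0 := h 4
  have h10 := hinner_eq_zero_symm h01
  have h21 := hinner_eq_zero_symm h12
  have h32 := hinner_eq_zero_symm h23
  have h43 := hinner_eq_zero_symm h34
  have h04 := hinner_eq_zero_symm h40
  have n012 := hw 0 1 2 (by decide) (by decide) (by decide)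
  have n013 := hw 0 1 3 (by decide) (by decide) (by decide)
  have n024 := hw 0 2 4 (by decide) (by decide) (by decide)
  have n014 := hw 0 1 4 (by decide) (by decide) (by decide)
  have n023 := hw 0 2 3 (by decide) (by decide) (by decide)
  have p1 := conj_det3_mul_det3 (w 0) (w 1) (w 4) (w 0) (w 2) (w 4)
  have p2 := conj_det3_mul_det3 (w 0) (w 2) (w 3) (w 0) (w 1) (w 3)
  have q1 := conj_det3_mul_det3 (w 0) (w 1) (w 4) (w 0) (w 1) (w 2)
  have q2 := conj_det3_mul_det3 (w 0) (w 1) (w 2) (w 0) (w 1) (w 3)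
  have q3 := conj_det3_mul_det3 (w 0) (w 1) (w 4) (w 0) (w 1) (w 3)
  simp only [h01, h12, h23, h40, h10, h21, h43, h04] at p1 p2 q1 q2 q3
  have key : hinner (w 1) (w 1) ^ 2 *
        (-(det3 (w 0) (w 1) (w 3) * det3 (w 0) (w 2) (w 4)) *
          conj (det3 (w 0) (w 1) (w 4) * det3 (w 0) (w 2) (w 3))) =
      hinner (w 0) (w 0) * (conj (det3 (w 0) (w 1) (w 2)) * det3 (w 0) (w 1) (w 2)) *
        (conj (hinner (w 1) (w 3)) * hinner (w 1) (w 3)) *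
        (conj (hinner (w 1) (w 4)) * hinner (w 1) (w 4)) := by
    rw [hinner_conj_symm, hinner_conj_symm, map_mul]
    linear_combination
      -hinner (w 1) (w 1) ^ 2 * conj (det3 (w 0) (w 2) (w 3)) * det3 (w 0) (w 1) (w 3) * p1 +
      hinner (w 1) (w 1) ^ 2 * hinner (w 0) (w 0) * hinner (w 1) (w 4) * hinner (w 4) (w 2) * p2 +
      hinner (w 3) (w 1) * hinner (w 1) (w 4) * (conj (det3 (w 0) (w 1) (w 2)) *
        det3 (w 0) (w 1) (w 3) * q1 + hinner (w 0) (w 0) * hinner (w 1) (w 1) *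
        hinner (w 4) (w 2) * q2 - conj (det3 (w 0) (w 1) (w 2)) * det3 (w 0) (w 1) (w 2) * q3)
  simp only [← Complex.normSq_eq_conj_mul_self, hinner_self_eq_ofReal] at key
  have hpos : 0 < ∑ a, Complex.normSq (w 1 a) := by
    obtain ⟨a, ha⟩ := Function.ne_iff.mp (hw.ne_zero 1)
    exact Finset.sum_pos' (fun _ _ => Complex.normSq_nonneg _)
      ⟨a, Finset.mem_univ a, Complex.normSq_pos.mpr ha⟩
  have hD : det3 (w 0) (w 1) (w 4) * det3 (w 0) (w 2) (w 3) ≠ 0 := mul_ne_zero n014 n023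
  have hs : s1 w ≠ 0 := div_ne_zero (neg_ne_zero.mpr (mul_ne_zero n013 n024)) hD
  have hN : -(det3 (w 0) (w 1) (w 3) * det3 (w 0) (w 2) (w 4)) =
      s1 w * (det3 (w 0) (w 1) (w 4) * det3 (w 0) (w 2) (w 3)) := (div_mul_cancel₀ _ hD).symm
  rw [hN, mul_assoc (s1 w), mul_comm _ (conj _), ← Complex.normSq_eq_conj_mul_self] at key
  refine isPosReal_of_mul_eq_ofReal
    (mul_pos (pow_pos hpos 2) (Complex.normSq_pos.mpr hD)) ?_ hs
    (q := (∑ a, Complex.normSq (w 0 a)) * Complex.normSq (det3 (w 0) (w 1) (w 2)) *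
      Complex.normSq (hinner (w 1) (w 3)) * Complex.normSq (hinner (w 1) (w 4))) ?_
  · have h0 := Finset.sum_nonneg fun a (_ : a ∈ Finset.univ) => Complex.normSq_nonneg (w 0 a)
    exact mul_nonneg (mul_nonneg (mul_nonneg h0 (Complex.normSq_nonneg _))
      (Complex.normSq_nonneg _)) (Complex.normSq_nonneg _)
  · push_cast at key ⊢
    linear_combination key

/-- The invariant `s₂` of an orthogonal pentagon is positive. -/
theorem isPosReal_s2_of_pentagon {w : Fin 5 → Fin 3 → ℂ} (hw : GeneralPosition w)
    (h : ∀ i, hinner (w i) (w (i + 1)) = 0) : IsPosReal (s2 w) := by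
  have hp : IsPosReal (s1 (w ∘ fun i => 1 - i)) := by
    refine isPosReal_s1_of_pentagon (hw.comp sub_right_injective) fun i => ?_
    have := hinner_eq_zero_symm (h (1 - (i + 1)))
    rwa [show 1 - (i + 1) + 1 = 1 - i by clear h this; decide +revert] at this
  obtain ⟨r, hr, he⟩ := hp.exists_ofReal
  rw [s1_reflect, inv_eq_iff_eq_inv, ← Complex.ofReal_inv] at he
  rw [he]
  exact isPosReal_ofReal (inv_pos.mpr hr)

theorem exists_pos_mul_conj_add_eq_zero {P P' Q Q' z : ℂ} (hP : P ≠ 0) (hP' : P' ≠ 0)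
    (hQ : Q ≠ 0) (hz : IsPosReal z) (h : z = -(P * Q') / (P' * Q)) :
    ∃ a : ℝ, 0 < a ∧ (a : ℂ) * conj Q * Q' + conj P * P' = 0 := by
  obtain ⟨r, hr, rfl⟩ := hz.exists_ofReal
  have hr' : (r : ℂ) ≠ 0 := by exact_mod_cast hr.ne'
  refine ⟨Complex.normSq P / (Complex.normSq Q * r),
    div_pos (Complex.normSq_pos.mpr hP) (mul_pos (Complex.normSq_pos.mpr hQ) hr), ?_⟩
  have hQc : conj Q ≠ 0 := (map_ne_zero _).mpr hQ
  rw [eq_div_iff (mul_ne_zero hP' hQ)] at h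
  push_cast
  rw [Complex.normSq_eq_conj_mul_self, Complex.normSq_eq_conj_mul_self]
  field_simp
  linear_combination conj P * h

/-- A family in general position with positive invariants is linearly equivalent to an orthogonal
pentagon. -/
theorem exists_pentagon {φ : Fin 5 → Fin 3 → ℂ} (hφ : GeneralPosition φ)
    (h1 : IsPosReal (s1 φ)) (h2 : IsPosReal (s2 φ)) :
    ∃ A : Matrix (Fin 3) (Fin 3) ℂ, A.det = 1 ∧
      ∀ i, hinner (A.mulVec (φ i)) (A.mulVec (φ (i + 1))) = 0 := by
  have rot (u v w) : det3 u v w = det3 v w u := by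
    simp [det3, Matrix.det_fin_three]; ring
  have swap (u v w) : det3 v u w = -det3 u v w := by
    simp [det3, Matrix.det_fin_three]; ring
  have rep (u v) : det3 u u v = 0 := by
    simp [det3, Matrix.det_fin_three]
  have rep' (u v) : det3 u v u = 0 := by
    simp [det3, Matrix.det_fin_three]
  have n201 := hφ 2 0 1 (by decide) (by decide) (by decide)
  have n301 := hφ 3 0 1 (by decide) (by decide) (by decide)
  have n401 := hφ 4 0 1 (by decide) (by decide) (by decide)
  have n302 := hφ 3 0 2 (by decide) (by decide) (by decide)
  have n214 := hφ 2 1 4 (by decide) (by decide) (by decide)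
  have n014 := hφ 0 1 4 (by decide) (by decide) (by decide)
  have n102 := hφ 1 0 2 (by decide) (by decide) (by decide)
  obtain ⟨a, ha, ha'⟩ := exists_pos_mul_conj_add_eq_zero
    (Q' := det3 (φ 3) (φ 1) (φ 4)) n201 n301 n214 h2 (by
      rw [s2, swap (φ 3) (φ 1), swap (φ 2) (φ 1), rot (φ 2) (φ 0), rot (φ 3) (φ 0)]
      simp only [mul_neg, neg_neg, div_neg, neg_div])
  obtain ⟨b, hb, hb'⟩ := exists_pos_mul_conj_add_eq_zero
    (Q' := det3 (φ 4) (φ 0) (φ 2)) n301 n401 n302 h1 (by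
      rw [s1, rot (φ 4) (φ 0) (φ 2), rot (φ 3) (φ 0), rot (φ 3) (φ 0), rot (φ 4) (φ 0)])
  let M : Matrix (Fin 3) (Fin 3) ℂ :=
    ![(√a : ℂ) • crossProduct (φ 1) (φ 4), (√b : ℂ) • crossProduct (φ 0) (φ 2),
      crossProduct (φ 0) (φ 1)]
  have hM (x) : M.mulVec x = ![√a * det3 x (φ 1) (φ 4), √b * det3 x (φ 0) (φ 2),
      det3 x (φ 0) (φ 1)] := by
    ext i
    fin_cases i <;>
    · simp [M, Matrix.mulVec, dotProduct, crossProduct, det3, Matrix.det_fin_three,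
        Fin.sum_univ_three]
      ring
  have hsa : (√a : ℂ) * √a = a := by exact_mod_cast Real.mul_self_sqrt ha.le
  have hsb : (√b : ℂ) * √b = b := by exact_mod_cast Real.mul_self_sqrt hb.le
  have hH (x y) : hinner (M.mulVec x) (M.mulVec y) =
      a * conj (det3 x (φ 1) (φ 4)) * det3 y (φ 1) (φ 4) +
      b * conj (det3 x (φ 0) (φ 2)) * det3 y (φ 0) (φ 2) +
      conj (det3 x (φ 0) (φ 1)) * det3 y (φ 0) (φ 1) := by
    rw [hM, hM, ← hsa, ← hsb]
    simp [hinner, Fin.sum_univ_three]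
    ring
  have hdet : M.det ≠ 0 := by
    intro h0
    have h := det3_mulVec M (φ 0) (φ 1) (φ 2)
    rw [h0, zero_mul, hM, hM, hM] at h
    have hsa0 : (√a : ℂ) ≠ 0 := by exact_mod_cast (Real.sqrt_pos.mpr ha).ne'
    have hsb0 : (√b : ℂ) ≠ 0 := by exact_mod_cast (Real.sqrt_pos.mpr hb).ne'
    have triangular (x y z u v w : ℂ) :
        det3 ![x, 0, 0] ![u, y, 0] ![v, w, z] = x * y * z := by
      simp [det3, Matrix.det_fin_three]
    simp only [rep, rep', mul_zero, triangular] at h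
    exact mul_ne_zero (mul_ne_zero (mul_ne_zero hsa0 n014) (mul_ne_zero hsb0 n102)) n201 h
  obtain ⟨t, ht⟩ := IsAlgClosed.exists_pow_nat_eq M.det⁻¹ (n := 3) (by norm_num)
  refine ⟨t • M, by rw [Matrix.det_smul, Fintype.card_fin, ht, inv_mul_cancel₀ hdet], fun i => ?_⟩
  rw [Matrix.smul_mulVec, Matrix.smul_mulVec, hinner_smul_left, hinner_smul_right, hH]
  fin_cases i <;> simp [rep, rep']
  · exact Or.inr ha'
  · exact Or.inr hb'

end Invariants

section Graph

/-- If each vertex of a graph on five vertices has at most two neighbours and at most two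
non-neighbours, the graph is a pentagon. -/
theorem exists_pentagon_labelling (R : Fin 5 → Fin 5 → Prop) (symm : ∀ i j, R i j → R j i)
    (hR : ∀ i (S : Finset (Fin 5)), (∀ j ∈ S, j ≠ i ∧ R i j) → S.card ≤ 2)
    (hR' : ∀ i (S : Finset (Fin 5)), (∀ j ∈ S, j ≠ i ∧ ¬ R i j) → S.card ≤ 2) :
    ∃ κ : Equiv.Perm (Fin 5), ∀ i, R (κ i) (κ (i + 1)) ∧ ¬ R (κ i) (κ (i + 2)) := by
  classical
  have two_of_three (i a b c : Fin 5) (hn : [i, a, b, c].Nodup) :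
      ¬ (R i a ∧ R i b ∧ R i c) ∧ ¬ (¬ R i a ∧ ¬ R i b ∧ ¬ R i c) := by
    simp only [List.nodup_cons, List.mem_cons, List.not_mem_nil, not_or, or_false] at hn
    obtain ⟨⟨hia, hib, hic⟩, ⟨hab, hac⟩, hbc, -⟩ := hn
    have hcard : ¬ ({a, b, c} : Finset (Fin 5)).card ≤ 2 := by
      rw [Finset.card_eq_three.mpr ⟨a, b, c, hab, hac, hbc, rfl⟩]
      decide
    exact ⟨fun h => hcard (hR i _ (by simp [h, Ne.symm hia, Ne.symm hib, Ne.symm hic])),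
      fun h => hcard (hR' i _ (by simp [h, Ne.symm hia, Ne.symm hib, Ne.symm hic]))⟩
  have extend (a b c d : Fin 5) (hn : [0, a, c, d, b].Nodup) (ha : R 0 a) (hb : R 0 b)
      (hc : ¬ R 0 c) (hd : ¬ R 0 d) (hab : ¬ R a b) (hac : R a c) :
      ∃ κ : Equiv.Perm (Fin 5), ∀ i, R (κ i) (κ (i + 1)) ∧ ¬ R (κ i) (κ (i + 2)) := by
    have hinj : Function.Injective ![0, a, c, d, b] := by
      rw [← List.nodup_ofFn]
      simpa using hn
    have hr := List.nodup_reverse.mpr hn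
    simp only [List.reverse_cons, List.reverse_nil, List.nil_append, List.cons_append,
      List.nodup_cons, List.mem_cons, List.not_mem_nil, not_or, or_false] at hn hr
    have had : ¬ R a d := fun h =>
      (two_of_three a 0 c d (by simp [hn, hr])).1 ⟨symm _ _ ha, hac, h⟩
    have hdb : R d b := by
      by_contra h
      exact (two_of_three d 0 a b (by simp [hn, hr])).2
        ⟨fun h => hd (symm _ _ h), fun h => had (symm _ _ h), h⟩
    have hdc : R d c := by
      by_contra h
      exact (two_of_three d 0 a c (by simp [hn, hr])).2
        ⟨fun h => hd (symm _ _ h), fun h => had (symm _ _ h), h⟩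
    have hcb : ¬ R c b := fun h =>
      (two_of_three c a d b (by simp [hn, hr])).1 ⟨symm _ _ hac, symm _ _ hdc, h⟩
    refine ⟨Equiv.ofBijective _ (Finite.injective_iff_bijective.mp hinj), fun i => ?_⟩
    fin_cases i
    · exact ⟨ha, hc⟩
    · exact ⟨hac, had⟩
    · exact ⟨symm _ _ hdc, hcb⟩
    · exact ⟨hdb, fun h => hd (symm _ _ h)⟩
    · exact ⟨symm _ _ hb, fun h => hab (symm _ _ h)⟩
  obtain ⟨a, b, c, d, hn, ha, hb, hc, hd⟩ : ∃ a b c d : Fin 5, [0, a, c, d, b].Nodup ∧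
      R 0 a ∧ R 0 b ∧ ¬ R 0 c ∧ ¬ R 0 d := by
    let S := (Finset.univ.erase 0).filter fun j => R 0 j
    let T := (Finset.univ.erase 0).filter fun j => ¬ R 0 j
    have hS : S.card ≤ 2 := hR 0 S (by simp [S])
    have hT : T.card ≤ 2 := hR' 0 T (by simp [T])
    have hST : S.card + T.card = 4 := Finset.card_filter_add_card_filter_not _
    obtain ⟨a, b, hab, hSab⟩ := Finset.card_eq_two.mp (show S.card = 2 by lia)
    obtain ⟨c, d, hcd, hTcd⟩ := Finset.card_eq_two.mp (show T.card = 2 by lia)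
    have ha : a ∈ S := by simp [hSab]
    have hb : b ∈ S := by simp [hSab]
    have hc : c ∈ T := by simp [hTcd]
    have hd : d ∈ T := by simp [hTcd]
    simp only [S, T, Finset.mem_filter, Finset.mem_erase, Finset.mem_univ, and_true]
      at ha hb hc hd
    refine ⟨a, b, c, d, ?_, ha.2, hb.2, hc.2, hd.2⟩
    have ne {x y : Fin 5} (hx : R 0 x) (hy : ¬ R 0 y) : x ≠ y := fun h => hy (h ▸ hx)
    simp [ha.1.symm, hb.1.symm, hc.1.symm, hd.1.symm, hab, hcd, ne ha.2 hc.2, ne ha.2 hd.2,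
      (ne hb.2 hc.2).symm, (ne hb.2 hd.2).symm]
  have hn' := hn
  have hr := List.nodup_reverse.mpr hn
  simp only [List.reverse_cons, List.reverse_nil, List.nil_append, List.cons_append,
    List.nodup_cons, List.mem_cons, List.not_mem_nil, not_or, or_false] at hn' hr
  have hab : ¬ R a b := by
    intro h
    have hac : ¬ R a c := fun h' =>
      (two_of_three a 0 b c (by simp [hn', hr])).1 ⟨symm _ _ ha, h, h'⟩
    have hbc : ¬ R b c := fun h' =>
      (two_of_three b 0 a c (by simp [hn', hr])).1 ⟨symm _ _ hb, symm _ _ h, h'⟩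
    exact (two_of_three c 0 a b (by simp [hn', hr])).2
      ⟨fun h => hc (symm _ _ h), fun h => hac (symm _ _ h), fun h => hbc (symm _ _ h)⟩
  by_cases hac : R a c
  · exact extend a b c d hn ha hb hc hd hab hac
  · refine extend a b d c ((((List.Perm.swap _ _ _).cons _).cons _).nodup_iff.mp hn) ha hb hd hc
      hab ?_
    by_contra h
    exact (two_of_three a b c d (by simp [hn', hr])).2 ⟨hab, hac, h⟩

end Graph

theorem stmt15 (φ ψ : Fin 5 → Fin 3 → ℂ)
    (hφ : ∀ S : Finset (Fin 5), S.card = 3 →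
      LinearIndependent ℂ (fun i : {x // x ∈ S} => φ i.1))
    (hψ : ∀ S : Finset (Fin 5), S.card = 3 →
      LinearIndependent ℂ (fun i : {x // x ∈ S} => ψ i.1)) :
    (∃ (A B : Matrix (Fin 3) (Fin 3) ℂ) (c : Fin 5 → ℂ),
      A.det = 1 ∧ B.det = 1 ∧ (∀ i, c i ≠ 0) ∧
      (∀ i j : Fin 5, i ≠ j →
        hinner (prodVec (c i • A.mulVec (φ i)) (B.mulVec (ψ i)))
          (prodVec (c j • A.mulVec (φ j)) (B.mulVec (ψ j))) = 0) ∧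
      ¬ ∃ (f g : Fin 3 → ℂ), f ≠ 0 ∧ g ≠ 0 ∧
        ∀ i, hinner (prodVec (c i • A.mulVec (φ i)) (B.mulVec (ψ i)))
          (prodVec f g) = 0) ↔
      (∃ κ : Equiv.Perm (Fin 5),
        IsPosReal (s1 (φ ∘ κ)) ∧ IsPosReal (s2 (φ ∘ κ)) ∧
        IsPosReal (s3 (ψ ∘ κ)) ∧ IsPosReal (s4 (ψ ∘ κ))) := by
  have gφ := generalPosition_of_linearIndependent hφ
  have gψ := generalPosition_of_linearIndependent hψ
  have two_mul_inj : Function.Injective fun i : Fin 5 => 2 * i := by decide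
  constructor
  · rintro ⟨A, B, c, hA, hB, hc, horth, -⟩
    have gA := gφ.mulVec hA
    have gB := gψ.mulVec hB
    have hor (i j : Fin 5) (hij : i ≠ j) : hinner (A.mulVec (φ i)) (A.mulVec (φ j)) = 0 ∨
        hinner (B.mulVec (ψ i)) (B.mulVec (ψ j)) = 0 := by
      simpa [hinner_prodVec, hinner_smul_left, hinner_smul_right, hc] using horth i j hij
    obtain ⟨κ, hκ⟩ := exists_pentagon_labelling
      (fun i j => hinner (A.mulVec (φ i)) (A.mulVec (φ j)) = 0)
      (fun i j h => hinner_eq_zero_symm h)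
      (fun i S hS => gA.card_orthogonal_le (gA.ne_zero i) fun j hj =>
        hinner_eq_zero_symm (hS j hj).2)
      (fun i S hS => gB.card_orthogonal_le (gB.ne_zero i) fun j hj =>
        hinner_eq_zero_symm ((hor i j (hS j hj).1.symm).resolve_left (hS j hj).2))
    have pA (i) : hinner (A.mulVec ((φ ∘ κ) i)) (A.mulVec ((φ ∘ κ) (i + 1))) = 0 := (hκ i).1
    have pB (i) : hinner (B.mulVec ((ψ ∘ κ ∘ fun i => 2 * i) i))
        (B.mulVec ((ψ ∘ κ ∘ fun i => 2 * i) (i + 1))) = 0 := by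
      have h := (hκ (2 * i)).2
      simp only [Function.comp_apply, mul_add, mul_one]
      exact (hor _ _ (κ.injective.ne (left_ne_add.mpr (by decide)))).resolve_left h
    have gA' := (gφ.comp κ.injective).mulVec hA
    have gB' := (gψ.comp (κ.injective.comp two_mul_inj)).mulVec hB
    simp only [s3_eq_s1, s4_eq_s2]
    refine ⟨κ, ?_, ?_, ?_, ?_⟩
    · exact s1_mulVec hA _ ▸ isPosReal_s1_of_pentagon gA' pA
    · exact s2_mulVec hA _ ▸ isPosReal_s2_of_pentagon gA' pA
    · exact s1_mulVec hB _ ▸ isPosReal_s1_of_pentagon gB' pB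
    · exact s2_mulVec hB _ ▸ isPosReal_s2_of_pentagon gB' pB
  · rintro ⟨κ, h1, h2, h3, h4⟩
    obtain ⟨A, hA, pA⟩ := exists_pentagon (gφ.comp κ.injective) h1 h2
    obtain ⟨B, hB, pB⟩ := exists_pentagon ((gψ.comp κ.injective).comp two_mul_inj) h3 h4
    have gA := gφ.mulVec hA
    have gB := gψ.mulVec hB
    refine ⟨A, B, 1, hA, hB, fun _ => one_ne_zero, fun i j hij => ?_, ?_⟩
    · obtain ⟨i, rfl⟩ := κ.surjective i
      obtain ⟨j, rfl⟩ := κ.surjective j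
      have hij' : i ≠ j := fun h => hij (congrArg κ h)
      rw [Pi.one_apply, Pi.one_apply, one_smul, one_smul, hinner_prodVec, mul_eq_zero]
      have pB' (i) : hinner (B.mulVec (ψ (κ i))) (B.mulVec (ψ (κ (i + 2)))) = 0 := by
        have h := pB (3 * i)
        simp only [Function.comp_apply, mul_add, ← mul_assoc, mul_one] at h
        rwa [show (2 * 3 : Fin 5) = 1 from rfl, one_mul] at h
      have hcases : j = i + 1 ∨ i = j + 1 ∨ j = i + 2 ∨ i = j + 2 := by
        clear * - hij'
        decide +revert
      rcases hcases with rfl | rfl | rfl | rfl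
      · exact Or.inl (pA i)
      · exact Or.inl (hinner_eq_zero_symm (pA j))
      · exact Or.inr (pB' i)
      · exact Or.inr (hinner_eq_zero_symm (pB' j))
    · classical
      rintro ⟨f, g, hf, hg, h⟩
      simp only [Pi.one_apply, one_smul, hinner_prodVec, mul_eq_zero] at h
      have hS := gA.card_orthogonal_le hf
        (S := Finset.univ.filter fun i => hinner (A.mulVec (φ i)) f = 0) (by simp)
      have hT := gB.card_orthogonal_le hg
        (S := Finset.univ.filter fun i => ¬ hinner (A.mulVec (φ i)) f = 0)
        fun i hi => (h i).resolve_left (Finset.mem_filter.mp hi).2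
      have hST := Finset.card_filter_add_card_filter_not (s := Finset.univ)
        fun i => hinner (A.mulVec (φ i)) f = 0
      rw [Finset.card_univ, Fintype.card_fin] at hST
      lia
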